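/- For every α ∈ [−1, 1], the function ξ_α is C^∞ on ℝ; its first derivative is ξ_α^{(1)}(z) = ψ(z)^{(1−α)/2}/(1 + ψ(z)), which lies in the open interval (0,1) for every z ∈ ℝ; and for every integer i ≥ 1 the i-th derivative ξ_α^{(i)} is bounded on ℝ. -/

import Mathlib

open Real Set

section InverseOfAddLog

variable {ψ : ℝ → ℝ}

theorem lipschitzWith_one_of_add_log_eq (hψ : ∀ z : ℝ, 0 < ψ z ∧ ψ z + Real.log (ψ z) = z) :
    LipschitzWith 1 ψ := by
  refine LipschitzWith.of_le_add fun x y => ?_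
  by_contra! h
  rw [Real.dist_eq] at h
  have hlt : ψ y < ψ x := by linarith [abs_nonneg (x - y)]
  have hlog := Real.log_lt_log (hψ y).1 hlt
  linarith [le_abs_self (x - y), (hψ x).2, (hψ y).2]

theorem hasDerivAt_of_add_log_eq (hψ : ∀ z : ℝ, 0 < ψ z ∧ ψ z + Real.log (ψ z) = z) (z : ℝ) :
    HasDerivAt ψ (ψ z / (1 + ψ z)) z := by
  have hz := (hψ z).1
  have hθ : HasDerivAt (fun y => y + Real.log y) (1 + (ψ z)⁻¹) (ψ z) :=
    (hasDerivAt_id (ψ z)).add (Real.hasDerivAt_log hz.ne')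
  have h := hθ.of_local_left_inverse
    (lipschitzWith_one_of_add_log_eq hψ).continuous.continuousAt (by positivity)
    (Filter.Eventually.of_forall fun y => (hψ y).2)
  refine h.congr_deriv ?_
  field_simp
  ring

theorem hasDerivAt_inv_one_add_of_add_log_eq
    (hψ : ∀ z : ℝ, 0 < ψ z ∧ ψ z + Real.log (ψ z) = z) (z : ℝ) :
    HasDerivAt (fun z => (1 + ψ z)⁻¹) (-((1 - (1 + ψ z)⁻¹) * (1 + ψ z)⁻¹ ^ 2)) z := by
  have hz := (hψ z).1
  have hne : 1 + ψ z ≠ 0 := by positivity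
  refine (((hasDerivAt_of_add_log_eq hψ z).const_add 1).inv hne).congr_deriv ?_
  field_simp
  ring

theorem hasDerivAt_rpow_of_add_log_eq
    (hψ : ∀ z : ℝ, 0 < ψ z ∧ ψ z + Real.log (ψ z) = z) (a z : ℝ) :
    HasDerivAt (fun z => ψ z ^ a) (a * (ψ z ^ a / (1 + ψ z))) z := by
  have hz := (hψ z).1
  have hne : 1 + ψ z ≠ 0 := by positivity
  refine ((hasDerivAt_of_add_log_eq hψ z).rpow_const (p := a) (Or.inl hz.ne')).congr_deriv ?_
  rw [Real.rpow_sub_one hz.ne']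
  field_simp

/-- Derivatives of `ψ ^ a / (1 + ψ)` times a polynomial in `1 / (1 + ψ)` have the same form. -/
theorem exists_hasDerivAt_rpow_div_mul_eval
    (hψ : ∀ z : ℝ, 0 < ψ z ∧ ψ z + Real.log (ψ z) = z) (a : ℝ) (P : Polynomial ℝ) :
    ∃ Q : Polynomial ℝ, ∀ z, HasDerivAt
      (fun z => ψ z ^ a / (1 + ψ z) * P.eval (1 + ψ z)⁻¹)
      (ψ z ^ a / (1 + ψ z) * Q.eval (1 + ψ z)⁻¹) z := by
  refine ⟨Polynomial.C a * Polynomial.X * P - (1 - Polynomial.X) * Polynomial.X *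
    (P + Polynomial.X * P.derivative), fun z => ?_⟩
  have hw := hasDerivAt_inv_one_add_of_add_log_eq hψ z
  have hP := (P.hasDerivAt (1 + ψ z)⁻¹).comp z hw
  refine (((hasDerivAt_rpow_of_add_log_eq hψ a z).mul hw).mul hP).congr_deriv ?_
  simp only [Polynomial.eval_sub, Polynomial.eval_mul, Polynomial.eval_add, Polynomial.eval_C,
    Polynomial.eval_X, Polynomial.eval_one, div_eq_mul_inv, Function.comp_apply, Pi.mul_apply]
  ring

end InverseOfAddLog

theorem rpow_div_one_add_mem_Ioo {x a : ℝ} (hx : 0 < x) (ha : a ∈ Icc (0 : ℝ) 1) :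
    x ^ a / (1 + x) ∈ Ioo (0 : ℝ) 1 := by
  refine ⟨by positivity, (div_lt_one (by positivity)).2 ?_⟩
  rcases le_total x 1 with h | h
  · linarith [Real.rpow_le_one hx.le h ha.1]
  · have := Real.rpow_le_rpow_of_exponent_le h ha.2
    rw [Real.rpow_one] at this
    linarith

/-- for every `α ∈ [−1,1]`, the function `ξ_α` (defined by
`ξ_α z = (2/(1−α)) ψ(z)^{(1−α)/2}` for `α ∈ [−1,1)`, and `ξ_1 z = log ψ(z) = z − ψ(z)`)
is `C^∞` on `ℝ`; its first derivative is `ψ(z)^{(1−α)/2}/(1+ψ(z)) ∈ (0,1)`, and every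
derivative of order `i ≥ 1` is bounded on `ℝ`. -/
theorem stmt_2 (ψ : ℝ → ℝ) (hψ : ∀ z : ℝ, 0 < ψ z ∧ ψ z + Real.log (ψ z) = z)
    (α : ℝ) (hα : α ∈ Icc (-1 : ℝ) 1)
    (ξ : ℝ → ℝ)
    (hξ : ∀ z : ℝ, ξ z = if α = 1 then z - ψ z else (2 / (1 - α)) * ψ z ^ ((1 - α) / 2)) :
    ContDiff ℝ ((⊤ : ℕ∞) : WithTop ℕ∞) ξ ∧
    (∀ z : ℝ, HasDerivAt ξ (ψ z ^ ((1 - α) / 2) / (1 + ψ z)) z ∧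
      ψ z ^ ((1 - α) / 2) / (1 + ψ z) ∈ Ioo (0 : ℝ) 1) ∧
    (∀ i : ℕ, 1 ≤ i → ∃ C : ℝ, ∀ z : ℝ, |iteratedDeriv i ξ z| ≤ C) := by
  set a := (1 - α) / 2 with ha_def
  have ha : a ∈ Icc (0 : ℝ) 1 := ⟨by linarith [hα.2], by linarith [hα.1]⟩
  have hder : ∀ z, HasDerivAt ξ (ψ z ^ a / (1 + ψ z)) z := by
    intro z
    have hz := (hψ z).1
    have hne : 1 + ψ z ≠ 0 := by positivity
    rw [funext hξ]
    by_cases h : α = 1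
    · have ha0 : a = 0 := by simp [ha_def, h]
      simp only [if_pos h, ha0, Real.rpow_zero]
      refine ((hasDerivAt_id z).sub (hasDerivAt_of_add_log_eq hψ z)).congr_deriv ?_
      field_simp
      ring
    · have h1 : 1 - α ≠ 0 := sub_ne_zero.2 (Ne.symm h)
      simp only [if_neg h]
      refine ((hasDerivAt_rpow_of_add_log_eq hψ a z).const_mul (2 / (1 - α))).congr_deriv ?_
      rw [← mul_assoc, show 2 / (1 - α) * a = 1 by rw [ha_def]; field_simp, one_mul]
  have hmem : ∀ z, ψ z ^ a / (1 + ψ z) ∈ Ioo (0 : ℝ) 1 := fun z =>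
    rpow_div_one_add_mem_Ioo (hψ z).1 ha
  have hiter : ∀ n : ℕ, ∃ P : Polynomial ℝ, iteratedDeriv (n + 1) ξ =
      fun z => ψ z ^ a / (1 + ψ z) * P.eval (1 + ψ z)⁻¹ := by
    intro n
    induction n with
    | zero => exact ⟨1, funext fun z => by simp [iteratedDeriv_one, (hder z).deriv]⟩
    | succ n ih =>
      obtain ⟨P, hP⟩ := ih
      obtain ⟨Q, hQ⟩ := exists_hasDerivAt_rpow_div_mul_eval hψ a P
      exact ⟨Q, by rw [iteratedDeriv_succ, hP]; exact funext fun z => (hQ z).deriv⟩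
  refine ⟨contDiff_of_differentiable_iteratedDeriv fun m _ => ?_,
    fun z => ⟨hder z, hmem z⟩, fun i hi => ?_⟩
  · cases m with
    | zero => rw [iteratedDeriv_zero]; exact fun z => (hder z).differentiableAt
    | succ n =>
      obtain ⟨P, hP⟩ := hiter n
      obtain ⟨Q, hQ⟩ := exists_hasDerivAt_rpow_div_mul_eval hψ a P
      rw [hP]
      exact fun z => (hQ z).differentiableAt
  · obtain ⟨n, rfl⟩ := Nat.exists_eq_add_of_le' hi
    obtain ⟨P, hP⟩ := hiter n
    obtain ⟨C, hC⟩ := (isCompact_Icc (a := (0 : ℝ)) (b := 1)).exists_bound_of_continuousOn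
      P.continuous.continuousOn
    refine ⟨C, fun z => ?_⟩
    have hz := (hψ z).1
    have hw : (1 + ψ z)⁻¹ ∈ Icc (0 : ℝ) 1 :=
      ⟨by positivity, inv_le_one_of_one_le₀ (by linarith)⟩
    rw [hP, abs_mul, abs_of_pos (hmem z).1]
    exact (mul_le_of_le_one_left (abs_nonneg _) (hmem z).2.le).trans (hC _ hw)
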